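/- If G is a finite nonempty claw-free simple graph without isolated vertices (i.e., G contains no induced subgraph isomorphic to K_{1,3}) and H is any finite nonempty simple graph without isolated vertices, then γ(G □ H) ≥ (2/3) · γ(G) · γ(H). -/

import Mathlib

open Finset

/-- `s` is a dominating set of `G`: every vertex is in `s` or adjacent to a vertex of `s`. -/
def IsDominatingSet {V : Type*} (G : SimpleGraph V) (s : Set V) : Prop :=
  ∀ v : V, v ∈ s ∨ ∃ u ∈ s, G.Adj u v

/-- The domination number `γ(G)`: minimum cardinality of a dominating set. -/
noncomputable def domNum {V : Type*} [Fintype V] (G : SimpleGraph V) : ℕ :=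
  sInf {n : ℕ | ∃ s : Set V, IsDominatingSet G s ∧ s.ncard = n}

/-- The allegiance `a_G(D) = max_{v ∈ V} |D ∩ N[v]|` (closed neighborhoods). -/
noncomputable def allegiance {V : Type*} [Fintype V] (G : SimpleGraph V) (D : Set V) : ℕ :=
  Finset.univ.sup fun v : V => (D ∩ (insert v (G.neighborSet v))).ncard

/-- The power `π(G)`: minimum allegiance over all minimum dominating sets (γ-sets) of `G`. -/
noncomputable def graphPower {V : Type*} [Fintype V] (G : SimpleGraph V) : ℕ :=
  sInf {a : ℕ | ∃ D : Set V, IsDominatingSet G D ∧ D.ncard = domNum G ∧ allegiance G D = a}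
/-- `G` is claw-free: it has no induced subgraph isomorphic to `K_{1,3}`, i.e. there is
no center `v` with three pairwise distinct, pairwise nonadjacent neighbors. -/
def ClawFree {V : Type*} (G : SimpleGraph V) : Prop :=
  ¬ ∃ v a b c : V, a ≠ b ∧ a ≠ c ∧ b ≠ c ∧
    G.Adj v a ∧ G.Adj v b ∧ G.Adj v c ∧ ¬ G.Adj a b ∧ ¬ G.Adj a c ∧ ¬ G.Adj b c

theorem domNum_le_card {V : Type*} [Fintype V] (G : SimpleGraph V) (s : Finset V)
    (hs : ∀ v, ∃ u ∈ s, u = v ∨ G.Adj u v) : domNum G ≤ #s := by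
  refine Nat.sInf_le ⟨(s : Set V), fun v => ?_, Set.ncard_coe_finset s⟩
  obtain ⟨u, hu, rfl | h⟩ := hs v
  · exact Or.inl hu
  · exact Or.inr ⟨u, hu, h⟩

theorem exists_dominating_card_eq_domNum {V : Type*} [Fintype V] (G : SimpleGraph V) :
    ∃ s : Finset V, (∀ v, ∃ u ∈ s, u = v ∨ G.Adj u v) ∧ #s = domNum G := by
  classical
  have hne : {n : ℕ | ∃ s : Set V, IsDominatingSet G s ∧ s.ncard = n}.Nonempty :=
    ⟨_, Set.univ, fun v => Or.inl (Set.mem_univ v), rfl⟩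
  obtain ⟨s, hs, hcard⟩ := Nat.sInf_mem hne
  refine ⟨s.toFinset, fun v => ?_, ?_⟩
  · rcases hs v with h | ⟨u, hu, h⟩
    · exact ⟨v, by simpa using h, Or.inl rfl⟩
    · exact ⟨u, by simpa using hu, Or.inr h⟩
  · rw [← Set.ncard_eq_toFinset_card']
    exact hcard

/-- Allan–Laskar: a claw-free graph has a minimum dominating set that is independent. -/
theorem exists_independent_dominating_of_clawFree {V : Type*} [Fintype V] (G : SimpleGraph V)
    (hclaw : ClawFree G) :
    ∃ s : Finset V, (∀ v, ∃ u ∈ s, u = v ∨ G.Adj u v) ∧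
      (∀ u ∈ s, ∀ v ∈ s, ¬ G.Adj u v) ∧ #s = domNum G := by
  classical
  let isolated : Finset V → Finset V := fun s => {v ∈ s | ∀ u ∈ s, ¬ G.Adj u v}
  let minDom : Finset (Finset V) :=
    {s | (∀ v, ∃ u ∈ s, u = v ∨ G.Adj u v) ∧ #s = domNum G}
  have hne : minDom.Nonempty := by
    obtain ⟨s, hs⟩ := exists_dominating_card_eq_domNum G
    exact ⟨s, by simpa [minDom] using hs⟩
  obtain ⟨s, hs, hmax⟩ := exists_max_image minDom (fun s => #(isolated s)) hne
  simp only [minDom, mem_filter, mem_univ, true_and] at hs hmax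
  obtain ⟨hdom, hcard⟩ := hs
  refine ⟨s, hdom, ?_, hcard⟩
  by_contra! hadj
  obtain ⟨u, hu, v, hv, huv⟩ := hadj
  have hpriv : ∃ w, ∀ x ∈ s, (x = w ∨ G.Adj x w) → x = v := by
    by_contra! h
    have := domNum_le_card G (s.erase v) (fun w => by
      obtain ⟨x, hx, hxw, hxv⟩ := h w
      exact ⟨x, mem_erase.2 ⟨hxv, hx⟩, hxw⟩)
    rw [card_erase_of_mem hv] at this
    have := card_pos.2 ⟨v, hv⟩
    omega
  obtain ⟨w, hw⟩ := hpriv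
  have hext : ∀ y, (∀ x ∈ s, (x = y ∨ G.Adj x y) → x = v) → G.Adj v y ∧ ¬ G.Adj u y ∧ u ≠ y := by
    intro y hy
    have h1 : ¬ (u = y ∨ G.Adj u y) := fun h => huv.ne (hy u hu h)
    push Not at h1
    refine ⟨?_, h1.2, h1.1⟩
    obtain ⟨x, hx, hxy⟩ := hdom y
    have := hy x hx hxy
    subst this
    rcases hxy with rfl | h
    · exact absurd huv h1.2
    · exact h
  have hws : w ∉ s := fun h => by
    have := hw w h (Or.inl rfl)
    exact (hext w hw).1.ne this.symm
  have hswap : ∀ y, ∃ x ∈ insert w (s.erase v), x = y ∨ G.Adj x y := by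
    intro y
    by_cases hy : ∀ x ∈ s, (x = y ∨ G.Adj x y) → x = v
    · refine ⟨w, mem_insert_self _ _, ?_⟩
      by_contra! h
      obtain ⟨h1, h2, h3⟩ := hext w hw
      obtain ⟨k1, k2, k3⟩ := hext y hy
      exact hclaw ⟨v, u, w, y, h3, k3, h.1, huv.symm, h1, k1, h2, k2, h.2⟩
    · push Not at hy
      obtain ⟨x, hx, hxy, hxv⟩ := hy
      exact ⟨x, mem_insert_of_mem (mem_erase.2 ⟨hxv, hx⟩), hxy⟩
  have hle := hmax (insert w (s.erase v)) ⟨hswap, by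
    rw [card_insert_of_notMem (fun h => hws (mem_of_mem_erase h)), card_erase_of_mem hv]
    have := card_pos.2 ⟨v, hv⟩
    omega⟩
  have hlt : isolated s ⊂ isolated (insert w (s.erase v)) := by
    have hnw : ∀ x ∈ s, x ≠ v → ¬ G.Adj x w := fun x hx hxv h => hxv (hw x hx (Or.inr h))
    rw [ssubset_iff_of_subset]
    · refine ⟨w, ?_, fun h => hws (mem_filter.1 h).1⟩
      simp only [isolated, mem_filter, mem_insert, mem_erase]
      refine ⟨by simp, ?_⟩
      rintro x (rfl | ⟨hxv, hx⟩)
      · exact G.loopless.irrefl _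
      · exact hnw x hx hxv
    · intro x hx
      simp only [isolated, mem_filter, mem_insert, mem_erase] at hx ⊢
      have hxv : x ≠ v := by
        rintro rfl
        exact hx.2 u hu huv
      refine ⟨Or.inr ⟨hxv, hx.1⟩, ?_⟩
      rintro y (rfl | ⟨-, hy⟩)
      · exact fun h => hnw x hx.1 hxv h.symm
      · exact hx.2 y hy
  exact absurd (card_lt_card hlt) (not_lt.2 hle)

open scoped Classical in
/-- Ore's bound relative to a vertex set `Y`: the vertices of `Y` with a neighbour in `Y` can be
dominated using at most half of them. -/
theorem exists_dominating_subset_two_mul_card_le {V : Type*} (G : SimpleGraph V)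
    (Y : Finset V) :
    ∃ B ⊆ Y, (∀ y ∈ Y, ∃ b ∈ B, b = y ∨ G.Adj b y) ∧
      2 * #B + #{y ∈ Y | ∃ x ∈ Y, G.Adj x y} ≤ 2 * #Y := by
  set N : Finset V := {y ∈ Y | ∃ x ∈ Y, G.Adj x y} with hN
  have hNmem : ∀ y, y ∈ N ↔ y ∈ Y ∧ ∃ x ∈ Y, G.Adj x y := fun y => by simp [hN]
  obtain ⟨B, hB, hmin⟩ := exists_min_image
    {B ∈ N.powerset | ∀ y ∈ N, ∃ b ∈ B, b = y ∨ G.Adj b y} card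
    ⟨N, by simpa using fun y hy => ⟨y, hy, Or.inl rfl⟩⟩
  simp only [mem_filter, mem_powerset] at hB hmin
  obtain ⟨hBN, hBdom⟩ := hB
  have hcompl : #B ≤ #(N \ B) := by
    refine hmin _ ⟨sdiff_subset, fun y hy => ?_⟩
    by_cases hyB : y ∈ B
    · by_contra! hno
      have hnbr : ∀ b ∈ N, G.Adj b y → b ∈ B := fun b hb hby => by
        by_contra h
        exact (hno b (mem_sdiff.2 ⟨hb, h⟩)).2 hby
      have := hmin (B.erase y) ⟨(erase_subset _ _).trans hBN, fun z hz => ?_⟩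
      · rw [card_erase_of_mem hyB] at this
        have := card_pos.2 ⟨y, hyB⟩
        omega
      · by_cases hzy : z = y
        · subst hzy
          obtain ⟨hz1, x, hx, hxz⟩ := (hNmem z).1 hy
          have hxN : x ∈ N := (hNmem x).2 ⟨hx, z, hz1, hxz.symm⟩
          exact ⟨x, mem_erase.2 ⟨hxz.ne, hnbr x hxN hxz⟩, Or.inr hxz⟩
        · by_cases hzB : z ∈ B
          · exact ⟨z, mem_erase.2 ⟨hzy, hzB⟩, Or.inl rfl⟩
          · obtain ⟨b, hb, hbz⟩ := hBdom z hz
            refine ⟨b, mem_erase.2 ⟨?_, hb⟩, hbz⟩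
            rintro rfl
            rcases hbz with rfl | h
            · exact hzB hb
            · exact hzB (hnbr z hz h.symm)
    · exact ⟨y, mem_sdiff.2 ⟨hy, hyB⟩, Or.inl rfl⟩
  have hNY : N ⊆ Y := filter_subset _ _
  refine ⟨B ∪ (Y \ N), union_subset (hBN.trans hNY) sdiff_subset, fun y hy => ?_, ?_⟩
  · by_cases hyN : y ∈ N
    · obtain ⟨b, hb, h⟩ := hBdom y hyN
      exact ⟨b, mem_union_left _ hb, h⟩
    · exact ⟨y, mem_union_right _ (mem_sdiff.2 ⟨hy, hyN⟩), Or.inl rfl⟩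
  · have h1 := card_union_le B (Y \ N)
    have h2 := card_sdiff_add_card_eq_card hNY
    have h3 := card_sdiff_add_card_eq_card hBN
    omega

open scoped Classical in
/-- The vertices of `s` whose closed neighbourhood contains `x`. -/
noncomputable def dominators {V : Type*} (G : SimpleGraph V) (s : Finset V) (x : V) : Finset V :=
  {v ∈ s | v = x ∨ G.Adj v x}

theorem mem_dominators {V : Type*} {G : SimpleGraph V} {s : Finset V} {x v : V} :
    v ∈ dominators G s x ↔ v ∈ s ∧ (v = x ∨ G.Adj v x) := by
  classical
  simp [dominators]

theorem dominators_eq_singleton {V : Type*} {G : SimpleGraph V} {s : Finset V}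
    (hind : ∀ u ∈ s, ∀ v ∈ s, ¬ G.Adj u v) {x : V} (hx : x ∈ s) : dominators G s x = {x} := by
  ext v
  rw [mem_dominators, mem_singleton]
  refine ⟨fun ⟨hv, h⟩ => h.resolve_right (hind v hv x hx), ?_⟩
  rintro rfl
  exact ⟨hx, Or.inl rfl⟩

theorem adj_of_mem_dominators {V : Type*} {G : SimpleGraph V} {s : Finset V}
    (hind : ∀ u ∈ s, ∀ v ∈ s, ¬ G.Adj u v) {x v : V} (hx : #(dominators G s x) ≠ 1)
    (hv : v ∈ dominators G s x) : G.Adj v x := by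
  obtain ⟨hvs, rfl | h⟩ := mem_dominators.1 hv
  · exact absurd (by rw [dominators_eq_singleton hind hvs, card_singleton]) hx
  · exact h

theorem card_dominators {V : Type*} {G : SimpleGraph V} (hclaw : ClawFree G) {s : Finset V}
    (hdom : ∀ v, ∃ u ∈ s, u = v ∨ G.Adj u v) (hind : ∀ u ∈ s, ∀ v ∈ s, ¬ G.Adj u v) (x : V) :
    #(dominators G s x) = 1 ∨ #(dominators G s x) = 2 := by
  classical
  have hpos : 0 < #(dominators G s x) := by
    obtain ⟨u, hu⟩ := hdom x
    exact card_pos.2 ⟨u, mem_dominators.2 hu⟩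
  by_contra! h
  obtain ⟨a, ha, b, hb, c, hc, hab, hac, hbc⟩ :=
    two_lt_card.1 (show 2 < #(dominators G s x) by omega)
  have hadj := fun v => adj_of_mem_dominators hind (v := v) h.1
  have hmem := fun v (hv : v ∈ dominators G s x) => (mem_dominators.1 hv).1
  exact hclaw ⟨x, a, b, c, hab, hac, hbc, (hadj a ha).symm, (hadj b hb).symm, (hadj c hc).symm,
    hind a (hmem a ha) b (hmem b hb), hind a (hmem a ha) c (hmem c hc),
    hind b (hmem b hb) c (hmem c hc)⟩

/-- A neighbour of a vertex with two dominators shares one of them. -/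
theorem exists_common_dominator {V : Type*} {G : SimpleGraph V} (hclaw : ClawFree G)
    {s : Finset V} (hind : ∀ u ∈ s, ∀ v ∈ s, ¬ G.Adj u v) {x y : V}
    (hy : #(dominators G s y) = 2) (hyx : y = x ∨ G.Adj y x) :
    ∃ i ∈ dominators G s y, i ∈ dominators G s x := by
  classical
  obtain ⟨a, b, hab, heq⟩ := card_eq_two.1 hy
  have ha : a ∈ dominators G s y := by simp [heq]
  have hb : b ∈ dominators G s y := by simp [heq]
  rcases hyx with rfl | hyx
  · exact ⟨a, ha, ha⟩
  by_contra! h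
  have has := (mem_dominators.1 ha).1
  have hbs := (mem_dominators.1 hb).1
  have hax : ¬ (a = x ∨ G.Adj a x) := fun hh => h a ha (mem_dominators.2 ⟨has, hh⟩)
  have hbx : ¬ (b = x ∨ G.Adj b x) := fun hh => h b hb (mem_dominators.2 ⟨hbs, hh⟩)
  push Not at hax hbx
  have hy1 : #(dominators G s y) ≠ 1 := by omega
  exact hclaw ⟨y, a, b, x, hab, hax.1, hbx.1, (adj_of_mem_dominators hind hy1 ha).symm,
    (adj_of_mem_dominators hind hy1 hb).symm, hyx, hind a has b hbs, hax.2, hbx.2⟩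

open scoped Classical in
/-- Let `s` be a minimum independent dominating set and let `R ⊆ S` consist of vertices having
two dominators, none of them shared with another vertex of `S`. In `s`, the dominators of `R` can
be replaced by `R`, the vertices of `S` with one dominator, and an independent set of vertices
missed by `S`; minimality of `s` bounds the number of vertices gained. -/
theorem two_mul_card_le_of_isolated {V : Type*} [Fintype V] {G : SimpleGraph V}
    (hclaw : ClawFree G) {s : Finset V}
    (hdom : ∀ v, ∃ u ∈ s, u = v ∨ G.Adj u v) (hind : ∀ u ∈ s, ∀ v ∈ s, ¬ G.Adj u v)
    (hmin : #s ≤ domNum G) (S R : Finset V) (hRS : R ⊆ S)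
    (hR2 : ∀ r ∈ R, #(dominators G s r) = 2)
    (hRiso : ∀ r ∈ R, ∀ y ∈ S, ∀ i, i ∈ dominators G s r → i ∈ dominators G s y → y = r)
    (hfull : ∀ i ∈ R.biUnion (dominators G s), ∀ x, dominators G s x = {i} →
      ∃ y ∈ S, y = x ∨ G.Adj y x) :
    2 * #R ≤ 2 * #{y ∈ S | #(dominators G s y) = 1} +
      #{i ∈ R.biUnion (dominators G s) | ∃ x, i ∈ dominators G s x ∧
        dominators G s x ⊆ R.biUnion (dominators G s) ∧ ∀ y ∈ S, ¬ (y = x ∨ G.Adj y x)} := by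
  set L := R.biUnion (dominators G s) with hL
  set P : Finset V := {y ∈ S | #(dominators G s y) = 1} with hP
  set M : Finset V := {i ∈ L | ∃ x, i ∈ dominators G s x ∧
        dominators G s x ⊆ L ∧ ∀ y ∈ S, ¬ (y = x ∨ G.Adj y x)} with hM
  have hLmem : ∀ i, i ∈ L ↔ ∃ r ∈ R, i ∈ dominators G s r := fun i => by simp [hL]
  have hLs : L ⊆ s := fun i hi => by
    obtain ⟨r, -, h⟩ := (hLmem i).1 hi
    exact (mem_dominators.1 h).1
  have hLcard : #L = 2 * #R := by
    rw [hL, card_biUnion, sum_congr rfl hR2, sum_const, smul_eq_mul, mul_comm]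
    intro x hx y hy hxy
    refine disjoint_left.2 fun i hi hi' => hxy ?_
    exact (hRiso x hx y (hRS hy) i hi hi').symm
  let X : Finset V := {x | dominators G s x ⊆ L ∧ ∀ y ∈ S, ¬ (y = x ∨ G.Adj y x)}
  have hX : ∀ x, x ∈ X ↔ dominators G s x ⊆ L ∧ ∀ y ∈ S, ¬ (y = x ∨ G.Adj y x) := fun x => by
    simp [X]
  have hX2 : ∀ x ∈ X, #(dominators G s x) = 2 := by
    intro x hx
    refine (card_dominators hclaw hdom hind x).resolve_left fun h1 => ?_
    obtain ⟨i, hi⟩ := card_eq_one.1 h1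
    rw [hX] at hx
    obtain ⟨y, hy, hyx⟩ := hfull i (hx.1 (by simp [hi])) x hi
    exact hx.2 y hy hyx
  have hXadj : ∀ x ∈ X, ∀ y ∈ X, ∀ i, i ∈ dominators G s x → i ∈ dominators G s y →
      x = y ∨ G.Adj x y := by
    intro x hx y hy i hix hiy
    have hx2 := hX2 x hx
    have hy2 := hX2 y hy
    rw [hX] at hx hy
    obtain ⟨r, hr, hir⟩ := (hLmem i).1 (hx.1 hix)
    have hr2 := hR2 r hr
    have hxr := hx.2 r (hRS hr)
    have hyr := hy.2 r (hRS hr)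
    push Not at hxr hyr
    by_contra! h
    exact hclaw ⟨i, r, x, y, hxr.1, hyr.1, h.1, adj_of_mem_dominators hind (by omega) hir,
      adj_of_mem_dominators hind (by omega) hix, adj_of_mem_dominators hind (by omega) hiy,
      hxr.2, hyr.2, h.2⟩
  obtain ⟨T, hT, hTmax⟩ := exists_max_image
    {T ∈ X.powerset | ∀ x ∈ T, ∀ y ∈ T, ¬ G.Adj x y} card ⟨∅, by simp⟩
  simp only [mem_filter, mem_powerset] at hT hTmax
  obtain ⟨hTX, hTind⟩ := hT
  have hTdom : ∀ x ∈ X, ∃ t ∈ T, t = x ∨ G.Adj t x := by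
    intro x hx
    by_contra! h
    have hxT : x ∉ T := fun hxT => (h x hxT).1 rfl
    have := hTmax (insert x T) ⟨insert_subset hx hTX, ?_⟩
    · rw [card_insert_of_notMem hxT] at this
      omega
    · intro a ha b hb
      rcases mem_insert.1 ha with rfl | ha' <;> rcases mem_insert.1 hb with rfl | hb'
      · exact G.loopless.irrefl _
      · exact fun hh => (h b hb').2 hh.symm
      · exact (h a ha').2
      · exact hTind a ha' b hb'
  have hTcard : 2 * #T ≤ #M := by
    have : #(T.biUnion (dominators G s)) = 2 * #T := by
      rw [card_biUnion, sum_congr rfl fun x hx => hX2 x (hTX hx), sum_const, smul_eq_mul,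
        mul_comm]
      intro x hx y hy hxy
      refine disjoint_left.2 fun i hi hi' => ?_
      rcases hXadj x (hTX hx) y (hTX hy) i hi hi' with h | h
      · exact hxy h
      · exact hTind x hx y hy h
    rw [← this]
    refine card_le_card fun i hi => ?_
    obtain ⟨x, hx, hix⟩ := mem_biUnion.1 hi
    have hxX := (hX x).1 (hTX hx)
    exact mem_filter.2 ⟨hxX.1 hix, x, hix, hxX⟩
  have hK : domNum G ≤ #(R ∪ P ∪ T ∪ (s \ L)) := by
    refine domNum_le_card G _ fun x => ?_
    by_cases hxL : dominators G s x ⊆ L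
    · by_cases hxS : ∀ y ∈ S, ¬ (y = x ∨ G.Adj y x)
      · obtain ⟨t, ht, h⟩ := hTdom x ((hX x).2 ⟨hxL, hxS⟩)
        exact ⟨t, by simp [ht], h⟩
      · push Not at hxS
        obtain ⟨y, hy, hyx⟩ := hxS
        rcases card_dominators hclaw hdom hind y with h1 | h2
        · exact ⟨y, by simp [hP, hy, h1], hyx⟩
        · obtain ⟨i, hiy, hix⟩ := exists_common_dominator hclaw hind h2 hyx
          obtain ⟨r, hr, hir⟩ := (hLmem i).1 (hxL hix)
          have := hRiso r hr y hy i hir hiy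
          subst this
          exact ⟨y, by simp [hr], hyx⟩
    · obtain ⟨i, hi, hiL⟩ := not_subset.1 hxL
      obtain ⟨his, h⟩ := mem_dominators.1 hi
      exact ⟨i, by simp [his, hiL], h⟩
  have h1 := card_union_le (R ∪ P ∪ T) (s \ L)
  have h2 := card_union_le (R ∪ P) T
  have h3 := card_union_le R P
  have h4 := card_sdiff_add_card_eq_card hLs
  omega

open scoped Classical in
/-- Every label gets weight one, split among the members of `D` carrying it. -/
theorem two_mul_card_labels_le {α β : Type*} (D : Finset α) (lab : α → Finset β)
    (hlab : ∀ z ∈ D, #(lab z) = 1 ∨ #(lab z) = 2) (Q : Finset α)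
    (hQ : ∀ z, z ∈ Q ↔ z ∈ D ∧ #(lab z) = 2 ∧
      ∀ z' ∈ D, ∀ f, f ∈ lab z → f ∈ lab z' → z' = z) :
    2 * #{f ∈ D.biUnion lab | ∀ z ∈ Q, f ∉ lab z} + 3 * #Q + #{z ∈ D | #(lab z) = 1}
      ≤ 3 * #D := by
  set F : Finset β := {f ∈ D.biUnion lab | ∀ z ∈ Q, f ∉ lab z} with hF
  have hQD : Q ⊆ D := fun z hz => ((hQ z).1 hz).1
  let w : β → ℕ := fun f => if #{z ∈ D | f ∈ lab z} = 1 then 2 else 1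
  have hw1 : ∀ f, 1 ≤ w f := fun f => by simp only [w]; split_ifs <;> omega
  have hw2 : ∀ f, w f ≤ 2 := fun f => by simp only [w]; split_ifs <;> omega
  have hlower : 2 * #F ≤ ∑ f ∈ F, ∑ z ∈ D \ Q, if f ∈ lab z then w f else 0 := by
    rw [mul_comm, ← smul_eq_mul, ← sum_const]
    refine sum_le_sum fun f hf => ?_
    obtain ⟨hfD, hfQ⟩ := mem_filter.1 hf
    obtain ⟨z, hz, hfz⟩ := mem_biUnion.1 hfD
    rw [← sum_filter, sum_const, smul_eq_mul]
    have heq : {z ∈ D \ Q | f ∈ lab z} = {z ∈ D | f ∈ lab z} := by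
      ext z
      simp only [mem_filter, mem_sdiff]
      exact ⟨fun h => ⟨h.1.1, h.2⟩, fun h => ⟨⟨h.1, fun hq => hfQ z hq h.2⟩, h.2⟩⟩
    have hpos : 0 < #{z ∈ D | f ∈ lab z} := card_pos.2 ⟨z, mem_filter.2 ⟨hz, hfz⟩⟩
    rw [heq]
    simp only [w]
    split_ifs with h
    · omega
    · omega
  have hupper : ∀ z ∈ D \ Q, (∑ f ∈ F, if f ∈ lab z then w f else 0)
      + (if #(lab z) = 1 then 1 else 0) ≤ 3 := by
    intro z hz
    obtain ⟨hzD, hzQ⟩ := mem_sdiff.1 hz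
    have hle : (∑ f ∈ F, if f ∈ lab z then w f else 0) ≤ ∑ f ∈ lab z, w f := by
      rw [← sum_filter]
      exact sum_le_sum_of_subset fun f hf => (mem_filter.1 hf).2
    rcases hlab z hzD with h1 | h2
    · rw [if_pos h1]
      obtain ⟨a, ha⟩ := card_eq_one.1 h1
      rw [ha, sum_singleton] at hle
      have := hw2 a
      simp only [ha] at *
      omega
    · rw [if_neg (by omega)]
      obtain ⟨z', hz', f, hfz, hfz', hne⟩ : ∃ z' ∈ D, ∃ f, f ∈ lab z ∧ f ∈ lab z' ∧ z' ≠ z := by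
        by_contra! h
        exact hzQ ((hQ z).2 ⟨hzD, h2, h⟩)
      have hwf : w f = 1 := by
        simp only [w]
        rw [if_neg]
        intro h
        obtain ⟨a, ha⟩ := card_eq_one.1 h
        have e1 : z ∈ ({a} : Finset α) := ha ▸ mem_filter.2 ⟨hzD, hfz⟩
        have e2 : z' ∈ ({a} : Finset α) := ha ▸ mem_filter.2 ⟨hz', hfz'⟩
        rw [mem_singleton] at e1 e2
        exact hne (e2.trans e1.symm)
      have hrest : ∑ g ∈ (lab z).erase f, w g ≤ #((lab z).erase f) • 2 :=
        sum_le_card_nsmul _ _ _ fun g _ => hw2 g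
      rw [card_erase_of_mem hfz, h2] at hrest
      have := add_sum_erase (lab z) w hfz
      simp only [smul_eq_mul] at hrest
      omega
  have hsum := sum_le_sum hupper
  rw [sum_add_distrib, sum_comm, sum_const, smul_eq_mul, ← card_filter] at hsum
  have hP : {z ∈ D \ Q | #(lab z) = 1} = {z ∈ D | #(lab z) = 1} := by
    ext z
    simp only [mem_filter, mem_sdiff]
    refine ⟨fun h => ⟨h.1.1, h.2⟩, fun h => ⟨⟨h.1, fun hq => ?_⟩, h.2⟩⟩
    have := ((hQ z).1 hq).2.1
    omega
  rw [hP] at hsum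
  have := card_sdiff_add_card_eq_card hQD
  omega

open scoped Classical in
/-- Extend `F` by at most one label from each set `lab z`, `z ∈ Q`, as long as the other label
of `z` is then adjacent to a chosen one; an extension that cannot be enlarged leaves no label of
the untouched members of `Q` adjacent to a chosen one. -/
theorem exists_saturated_extension {α β : Type*} [Fintype β] (K : SimpleGraph β)
    (Q : Finset α) (lab : α → Finset β) (F : Finset β)
    (hcard : ∀ z ∈ Q, #(lab z) = 2)
    (hdisj : ∀ z ∈ Q, ∀ z' ∈ Q, ∀ f, f ∈ lab z → f ∈ lab z' → z' = z)
    (hF : ∀ z ∈ Q, Disjoint (lab z) F) :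
    ∃ A : Finset β, F ⊆ A ∧ #A ≤ #F + #{z ∈ Q | ¬ Disjoint (lab z) A} ∧
      (∀ z ∈ Q, ¬ Disjoint (lab z) A → ∀ f ∈ lab z, ∃ g ∈ A, g = f ∨ K.Adj g f) ∧
      (∀ z ∈ Q, Disjoint (lab z) A → ∀ f ∈ lab z, ∀ g ∈ A, ¬ K.Adj g f) := by
  obtain ⟨A, hA, hmax⟩ := exists_max_image
    ({A | F ⊆ A ∧ #A ≤ #F + #{z ∈ Q | ¬ Disjoint (lab z) A} ∧
      (∀ z ∈ Q, ¬ Disjoint (lab z) A → ∀ f ∈ lab z, ∃ g ∈ A, g = f ∨ K.Adj g f)} :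
      Finset (Finset β)) card
    ⟨F, by
      simp only [mem_filter, mem_univ, true_and]
      exact ⟨Subset.rfl, Nat.le_add_right _ _, fun z hz h => absurd (hF z hz) h⟩⟩
  simp only [mem_filter, mem_univ, true_and] at hA hmax
  obtain ⟨hFA, hAcard, hAdom⟩ := hA
  refine ⟨A, hFA, hAcard, hAdom, fun z hz hzA f hf g hg hgf => ?_⟩
  obtain ⟨f', hf', hne⟩ : ∃ f' ∈ lab z, f' ≠ f :=
    exists_mem_ne (by rw [hcard z hz]; norm_num) f
  have hpair : ∀ e ∈ lab z, e = f ∨ e = f' := by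
    intro e he
    by_contra! h
    have : ({e, f, f'} : Finset β) ⊆ lab z := by
      intro x hx
      simp only [mem_insert, mem_singleton] at hx
      rcases hx with rfl | rfl | rfl <;> assumption
    have h3 := card_le_card this
    rw [card_eq_three.2 ⟨e, f, f', h.1, h.2, hne.symm, rfl⟩, hcard z hz] at h3
    omega
  have hf'A : f' ∉ A := disjoint_left.1 hzA hf'
  have hsub : insert z {z ∈ Q | ¬ Disjoint (lab z) A} ⊆
      {z ∈ Q | ¬ Disjoint (lab z) (insert f' A)} := by
    intro x hx
    rcases mem_insert.1 hx with rfl | hx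
    · exact mem_filter.2 ⟨hz, fun h => disjoint_left.1 h hf' (mem_insert_self _ _)⟩
    · obtain ⟨hxQ, hxA⟩ := mem_filter.1 hx
      exact mem_filter.2 ⟨hxQ, fun h => hxA (h.mono_right (subset_insert _ _))⟩
  have hle := card_le_card hsub
  rw [card_insert_of_notMem (by simp [hzA])] at hle
  have := hmax (insert f' A) ⟨hFA.trans (subset_insert _ _), ?_, ?_⟩
  · rw [card_insert_of_notMem hf'A] at this
    omega
  · rw [card_insert_of_notMem hf'A]
    omega
  · intro x hx hxA e he
    by_cases hxz : x = z
    · subst hxz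
      rcases hpair e he with rfl | rfl
      · exact ⟨g, mem_insert_of_mem hg, Or.inr hgf⟩
      · exact ⟨e, mem_insert_self _ _, Or.inl rfl⟩
    · have hxA' : ¬ Disjoint (lab x) A := by
        intro h
        refine hxA (disjoint_insert_right.2 ⟨fun hfx => hxz ?_, h⟩)
        exact hdisj z hz x hx f' hf' hfx
      obtain ⟨c, hc, h⟩ := hAdom x hx hxA' e he
      exact ⟨c, mem_insert_of_mem hc, h⟩

open scoped Classical in
theorem sum_card_fiber {V W : Type*} [Fintype V] [Fintype W] (A : Finset (V × W)) :
    ∑ h : W, #{x : V | (x, h) ∈ A} = #A := by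
  simp only [card_filter]
  rw [← Fintype.sum_prod_type_right (fun p : V × W => if p ∈ A then 1 else 0), ← card_filter]
  simp

open scoped Classical in
theorem card_mul_domNum_le {V W : Type*} [Fintype V] [Fintype W] (H : SimpleGraph W)
    (s : Finset V) (A : Finset (V × W))
    (hA : ∀ i ∈ s, ∀ h, ∃ h', (i, h') ∈ A ∧ (h' = h ∨ H.Adj h' h)) :
    #s * domNum H ≤ #A := by
  have hfib : ∑ i : V, #{h : W | (i, h) ∈ A} = #A := by
    simp only [card_filter]
    rw [← Fintype.sum_prod_type (fun p : V × W => if p ∈ A then 1 else 0), ← card_filter]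
    simp
  calc #s * domNum H = ∑ i ∈ s, domNum H := by rw [sum_const, smul_eq_mul]
    _ ≤ ∑ i ∈ s, #{h : W | (i, h) ∈ A} := by
      refine sum_le_sum fun i hi => domNum_le_card H _ fun h => ?_
      obtain ⟨h', h1, h2⟩ := hA i hi h
      exact ⟨h', by simpa using h1, h2⟩
    _ ≤ ∑ i : V, #{h : W | (i, h) ∈ A} := sum_le_sum_of_subset (subset_univ _)
    _ = #A := hfib

open scoped Classical in
theorem two_mul_domNum_mul_domNum_le {V W : Type*} [Fintype V] [Fintype W]
    (G : SimpleGraph V) (H : SimpleGraph W) (hclaw : ClawFree G) :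
    2 * (domNum G * domNum H) ≤ 3 * domNum (G □ H) := by
  obtain ⟨s, hdom, hind, hs⟩ := exists_independent_dominating_of_clawFree G hclaw
  obtain ⟨D, hDdom, hD⟩ := exists_dominating_card_eq_domNum (G □ H)
  have hDdom' : ∀ x h, (∃ y, (y, h) ∈ D ∧ (y = x ∨ G.Adj y x)) ∨
      ∃ h', (x, h') ∈ D ∧ H.Adj h' h := by
    intro x h
    obtain ⟨⟨y, h'⟩, hy, heq | hadj⟩ := hDdom (x, h)
    · obtain ⟨rfl, rfl⟩ := Prod.mk.inj heq
      exact Or.inl ⟨y, hy, Or.inl rfl⟩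
    · rcases SimpleGraph.boxProd_adj.1 hadj with ⟨h1, h2⟩ | ⟨h1, h2⟩
      · dsimp only at h1 h2
        subst h2
        exact Or.inl ⟨y, hy, Or.inr h1⟩
      · dsimp only at h1 h2
        subst h2
        exact Or.inr ⟨h', hy, h1⟩
  let lab : V × W → Finset (V × W) := fun z => dominators G s z.1 ×ˢ {z.2}
  have hlab : ∀ i h x h', (i, h) ∈ lab (x, h') ↔ i ∈ dominators G s x ∧ h = h' := by
    intro i h x h'
    simp only [lab, mem_product, mem_singleton]
  have hlabcard : ∀ z, #(lab z) = #(dominators G s z.1) := by simp [lab]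
  let Q : Finset (V × W) := {z ∈ D | #(lab z) = 2 ∧
      ∀ z' ∈ D, ∀ f, f ∈ lab z → f ∈ lab z' → z' = z}
  have hQ : ∀ z, z ∈ Q ↔ z ∈ D ∧ #(lab z) = 2 ∧
      ∀ z' ∈ D, ∀ f, f ∈ lab z → f ∈ lab z' → z' = z := by simp [Q]
  set F : Finset (V × W) := {f ∈ D.biUnion lab | ∀ z ∈ Q, f ∉ lab z} with hF
  have hFmem : ∀ z ∈ D, z ∉ Q → lab z ⊆ F := by
    intro z hz hzQ f hf
    refine mem_filter.2 ⟨mem_biUnion.2 ⟨z, hz, hf⟩, fun z' hz' hf' => hzQ ?_⟩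
    rwa [((hQ z').1 hz').2.2 z hz f hf' hf]
  let K : SimpleGraph (V × W) := (⊥ : SimpleGraph V) □ H
  have hK : ∀ i h i' h', K.Adj (i, h) (i', h') ↔ H.Adj h h' ∧ i = i' := by
    simp [K, SimpleGraph.boxProd_adj]
  obtain ⟨A, hFA, hAcard, hAdom, hAsat⟩ := exists_saturated_extension K Q lab F
    (fun z hz => ((hQ z).1 hz).2.1)
    (fun z hz z' hz' => ((hQ z).1 hz).2.2 z' ((hQ z').1 hz').1)
    (fun z hz => disjoint_left.2 fun f hf hfF => (mem_filter.1 hfF).2 z hz hf)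
  set R : Finset (V × W) := {z ∈ Q | Disjoint (lab z) A} with hR
  have hRmem : ∀ z, z ∈ R ↔ z ∈ Q ∧ Disjoint (lab z) A := by simp [hR]
  set Y := R.biUnion lab with hY
  have hYsat : ∀ f ∈ Y, ∀ g ∈ A, ¬ K.Adj g f := by
    intro f hf
    obtain ⟨z, hz, hfz⟩ := mem_biUnion.1 hf
    obtain ⟨hzQ, hzA⟩ := (hRmem z).1 hz
    exact hAsat z hzQ hzA f hfz
  obtain ⟨B, -, hBdom, hBcard⟩ := exists_dominating_subset_two_mul_card_le K Y
  have hYcard : #Y ≤ 2 * #R := by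
    rw [mul_comm]
    exact card_biUnion_le_card_mul _ _ _ fun z hz =>
      ((hQ z).1 ((hRmem z).1 hz).1).2.1.le
  set N : Finset (V × W) := {y ∈ Y | ∃ x ∈ Y, K.Adj x y} with hN
  set P : Finset (V × W) := {z ∈ D | #(lab z) = 1} with hP
  have hfiber : 2 * #R ≤ 2 * #P + #N := by
    rw [← sum_card_fiber R, ← sum_card_fiber P, ← sum_card_fiber N, mul_sum, mul_sum,
      ← sum_add_distrib]
    refine sum_le_sum fun h _ => ?_
    have hLY : ∀ i, i ∈ ({x : V | (x, h) ∈ R} : Finset V).biUnion (dominators G s) ↔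
        (i, h) ∈ Y := by
      intro i
      simp only [hY, mem_biUnion, mem_filter, mem_univ, true_and, Prod.exists, hlab]
      constructor
      · rintro ⟨r, hr, hi⟩
        exact ⟨r, h, hr, hi, rfl⟩
      · rintro ⟨r, h', hr, hi, rfl⟩
        exact ⟨r, hr, hi⟩
    have key := two_mul_card_le_of_isolated hclaw hdom hind hs.le
      {x : V | (x, h) ∈ D} {x : V | (x, h) ∈ R} ?_ ?_ ?_ ?_
    · refine key.trans (Nat.add_le_add (Nat.mul_le_mul_left 2 (card_le_card ?_))
        (card_le_card ?_))
      · intro x hx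
        simpa [hP, hlabcard] using hx
      · intro i hi
        obtain ⟨hiL, x, hix, hxL, hxS⟩ := mem_filter.1 hi
        have hxS' : ¬ ∃ y, (y, h) ∈ D ∧ (y = x ∨ G.Adj y x) := by
          rintro ⟨y, hy, hyx⟩
          exact hxS y (by simpa using hy) hyx
        obtain ⟨h', hxD, hadj⟩ := (hDdom' x h).resolve_left hxS'
        have hlabA : ∀ j ∈ dominators G s x, (j, h') ∉ A := fun j hj hjA =>
          hYsat (j, h) ((hLY j).1 (hxL hj)) _ hjA ((hK _ _ _ _).2 ⟨hadj, rfl⟩)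
        have hxQ : (x, h') ∈ Q := by
          by_contra hxQ
          exact hlabA i hix (hFA (hFmem _ hxD hxQ ((hlab _ _ _ _).2 ⟨hix, rfl⟩)))
        have hxR : (x, h') ∈ R := by
          refine (hRmem _).2 ⟨hxQ, disjoint_left.2 ?_⟩
          rintro ⟨j, h''⟩ hj
          obtain ⟨hjx, rfl⟩ := (hlab _ _ _ _).1 hj
          exact hlabA j hjx
        simp only [hN, mem_filter, mem_univ, true_and]
        exact ⟨(hLY i).1 hiL, (i, h'), mem_biUnion.2 ⟨_, hxR, (hlab _ _ _ _).2 ⟨hix, rfl⟩⟩,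
          (hK _ _ _ _).2 ⟨hadj, rfl⟩⟩
    · intro x hx
      simp only [mem_filter, mem_univ, true_and] at hx ⊢
      exact ((hQ _).1 ((hRmem _).1 hx).1).1
    · intro r hr
      simp only [mem_filter, mem_univ, true_and] at hr
      rw [← ((hQ _).1 ((hRmem _).1 hr).1).2.1, hlabcard]
    · intro r hr y hy i hir hiy
      simp only [mem_filter, mem_univ, true_and] at hr hy
      have := ((hQ _).1 ((hRmem _).1 hr).1).2.2 (y, h) hy (i, h)
        ((hlab _ _ _ _).2 ⟨hir, rfl⟩) ((hlab _ _ _ _).2 ⟨hiy, rfl⟩)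
      exact congrArg Prod.fst this
    · intro i hi x hx
      rcases hDdom' x h with ⟨y, hy, hyx⟩ | ⟨h', hxD, hadj⟩
      · exact ⟨y, by simpa using hy, hyx⟩
      · exfalso
        have hxQ : (x, h') ∉ Q := by
          intro hxQ
          have := ((hQ _).1 hxQ).2.1
          simp [hlabcard, hx] at this
        have hiF : (i, h') ∈ F := hFmem _ hxD hxQ ((hlab _ _ _ _).2 ⟨by simp [hx], rfl⟩)
        exact hYsat (i, h) ((hLY i).1 hi) _ (hFA hiF) ((hK _ _ _ _).2 ⟨hadj, rfl⟩)
  have hlabels : 2 * #F + 3 * #Q + #P ≤ 3 * #D := by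
    convert two_mul_card_labels_le D lab
      (fun z _ => by rw [hlabcard]; exact card_dominators hclaw hdom hind z.1) Q hQ
  have hI : #(D.biUnion lab) ≤ #F + 2 * #Q := by
    have hsub : D.biUnion lab ⊆ F ∪ Q.biUnion lab := by
      intro f hf
      by_cases h : ∃ z ∈ Q, f ∈ lab z
      · exact mem_union_right _ (mem_biUnion.2 h)
      · push Not at h
        exact mem_union_left _ (mem_filter.2 ⟨hf, h⟩)
    have h1 := card_biUnion_le_card_mul Q lab 2 fun z hz => ((hQ z).1 hz).2.1.le
    have h2 := (card_le_card hsub).trans (card_union_le _ _)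
    omega
  have hfirst : #s * domNum H ≤ #(D.biUnion lab) := by
    refine card_mul_domNum_le H s _ fun i hi h => ?_
    rcases hDdom' i h with ⟨y, hy, hyi⟩ | ⟨h', hiD, hadj⟩
    · refine ⟨h, mem_biUnion.2 ⟨_, hy, (hlab _ _ _ _).2 ⟨mem_dominators.2 ⟨hi, ?_⟩, rfl⟩⟩,
        Or.inl rfl⟩
      exact hyi.imp Eq.symm fun h => h.symm
    · exact ⟨h', mem_biUnion.2 ⟨_, hiD, (hlab _ _ _ _).2
        ⟨mem_dominators.2 ⟨hi, Or.inl rfl⟩, rfl⟩⟩, Or.inr hadj⟩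
  have hsecond : #s * domNum H ≤ #(A ∪ B) := by
    refine card_mul_domNum_le H s _ fun i hi h => ?_
    suffices hd : ∃ g ∈ A ∪ B, g = (i, h) ∨ K.Adj g (i, h) by
      obtain ⟨⟨j, h'⟩, hg, heq | hgi⟩ := hd
      · obtain ⟨rfl, rfl⟩ := Prod.mk.inj heq
        exact ⟨h', hg, Or.inl rfl⟩
      · obtain ⟨hadj, rfl⟩ := (hK _ _ _ _).1 hgi
        exact ⟨h', hg, Or.inr hadj⟩
    rcases hDdom' i h with ⟨y, hy, hyi⟩ | ⟨h', hiD, hadj⟩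
    · have hiy : (i, h) ∈ lab (y, h) :=
        (hlab _ _ _ _).2 ⟨mem_dominators.2 ⟨hi, hyi.imp Eq.symm fun h => h.symm⟩, rfl⟩
      by_cases hyQ : (y, h) ∈ Q
      · by_cases hyA : Disjoint (lab (y, h)) A
        · obtain ⟨b, hb, hbi⟩ := hBdom (i, h) (mem_biUnion.2 ⟨_, (hRmem _).2 ⟨hyQ, hyA⟩, hiy⟩)
          exact ⟨b, mem_union_right _ hb, hbi⟩
        · obtain ⟨g, hg, hgi⟩ := hAdom _ hyQ hyA _ hiy
          exact ⟨g, mem_union_left _ hg, hgi⟩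
      · exact ⟨_, mem_union_left _ (hFA (hFmem _ hy hyQ hiy)), Or.inl rfl⟩
    · have hiQ : (i, h') ∉ Q := by
        intro hiQ
        have := ((hQ _).1 hiQ).2.1
        simp [hlabcard, dominators_eq_singleton hind hi] at this
      have hiF : (i, h') ∈ F := hFmem _ hiD hiQ
        ((hlab _ _ _ _).2 ⟨mem_dominators.2 ⟨hi, Or.inl rfl⟩, rfl⟩)
      exact ⟨_, mem_union_left _ (hFA hiF), Or.inr ((hK _ _ _ _).2 ⟨hadj, rfl⟩)⟩
  have hAB := card_union_le A B
  have hsplit : #R + #{z ∈ Q | ¬ Disjoint (lab z) A} = #Q :=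
    card_filter_add_card_filter_not _
  have hAcard' : #A ≤ #F + #{z ∈ Q | ¬ Disjoint (lab z) A} := by convert hAcard
  rw [hs] at hfirst hsecond
  omega

/-- If `G` is a finite nonempty claw-free graph without isolated vertices and
`H` is any finite nonempty graph without isolated vertices, then
`γ(G □ H) ≥ (2/3)·γ(G)·γ(H)`. -/
theorem domNum_boxProd_ge_of_clawFree {V W : Type*} [Fintype V] [Fintype W]
    [Nonempty V] [Nonempty W] (G : SimpleGraph V) (H : SimpleGraph W)
    (hclaw : ClawFree G)
    (hG : ∀ v : V, ∃ u : V, G.Adj u v) (hH : ∀ w : W, ∃ u : W, H.Adj u w) :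
    (domNum (G □ H) : ℝ) ≥ 2 / 3 * (domNum G : ℝ) * (domNum H : ℝ) := by
  have h : (2 : ℝ) * (domNum G * domNum H) ≤ 3 * domNum (G □ H) := by
    exact_mod_cast two_mul_domNum_mul_domNum_le G H hclaw
  linarith
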